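/- Let Z be an m×n real matrix with full singular value decomposition Z = U D Vᵀ (U m×m orthogonal, V n×n orthogonal, D m×n with diagonal entries d_1 ≥ ... ≥ d_{min(m,n)} ≥ 0 and zeros elsewhere). Fix r ≤ min(m,n) and γ₁, γ₂ > 0, let U_r, V_r be the first r columns of U, V, and let D̄_r^γ be the r×r diagonal matrix with entries max(d_i − √(γ₁γ₂), 0), i = 1,...,r. Then F̄ = (γ₂/γ₁)^{1/4} U_r (D̄_r^γ)^{1/2} and Λ̄ = (γ₁/γ₂)^{1/4} V_r (D̄_r^γ)^{1/2} are global minimizers of (F, Λ) ↦ (1/2)‖Z − F Λᵀ‖_F² + (γ₁/2)‖F‖_F² + (γ₂/2)‖Λ‖_F² over all m×r matrices F and n×r matrices Λ, and the corresponding common component is F̄ Λ̄ᵀ = U_r D̄_r^γ V_rᵀ. -/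

import Mathlib

open Matrix

/-- Frobenius norm of a real matrix: square root of the sum of squared entries. -/
noncomputable def frobNorm {m n : Type*} [Fintype m] [Fintype n] (M : Matrix m n ℝ) : ℝ :=
  Real.sqrt (∑ i, ∑ j, (M i j) ^ 2)

lemma sq_frobNorm {m n : Type*} [Fintype m] [Fintype n] (M : Matrix m n ℝ) :
    frobNorm M ^ 2 = (Mᵀ * M).trace := by
  rw [frobNorm, Real.sq_sqrt (by positivity), Finset.sum_comm]
  simp [trace, mul_apply, sq]

lemma sq_frobNorm_sub {m n : Type*} [Fintype m] [Fintype n] (A B : Matrix m n ℝ) :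
    frobNorm (A - B) ^ 2 = frobNorm A ^ 2 - 2 * (Aᵀ * B).trace + frobNorm B ^ 2 := by
  have h : (Bᵀ * A).trace = (Aᵀ * B).trace := by
    rw [← trace_transpose, transpose_mul, transpose_transpose]
  simp only [sq_frobNorm, transpose_sub, Matrix.sub_mul, Matrix.mul_sub, trace_sub, h]
  ring

lemma sq_frobNorm_smul {m n : Type*} [Fintype m] [Fintype n] (c : ℝ) (A : Matrix m n ℝ) :
    frobNorm (c • A) ^ 2 = c ^ 2 * frobNorm A ^ 2 := by
  simp only [sq_frobNorm, transpose_smul, Matrix.smul_mul, Matrix.mul_smul, trace_smul, smul_eq_mul]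
  ring

/-- Left multiplication by a matrix with orthonormal columns preserves the Frobenius norm. -/
lemma sq_frobNorm_mul_of_transpose_mul_self {l m n : Type*} [Fintype l] [Fintype m] [Fintype n]
    [DecidableEq m] {W : Matrix l m ℝ} (hW : Wᵀ * W = 1) (A : Matrix m n ℝ) :
    frobNorm (W * A) ^ 2 = frobNorm A ^ 2 := by
  rw [sq_frobNorm, sq_frobNorm, transpose_mul, Matrix.mul_assoc, ← Matrix.mul_assoc Wᵀ, hW,
    Matrix.one_mul]

lemma frobNorm_transpose {m n : Type*} [Fintype m] [Fintype n] (A : Matrix m n ℝ) :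
    frobNorm Aᵀ = frobNorm A := by
  simp only [frobNorm, transpose_apply]
  rw [Finset.sum_comm]

/-- The columns of a matrix lie in the span of at most as many orthonormal vectors. -/
lemma exists_orthonormal_columns {m r : ℕ} (G : Matrix (Fin m) (Fin r) ℝ) :
    ∃ k ≤ r, ∃ E : Matrix (Fin m) (Fin k) ℝ, Eᵀ * E = 1 ∧ E * Eᵀ * G = G := by
  let g : Fin r → EuclideanSpace ℝ (Fin m) := fun a => WithLp.toLp 2 (fun i => G i a)
  let S := Submodule.span ℝ (Set.range g)
  let b := stdOrthonormalBasis ℝ S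
  refine ⟨Module.finrank ℝ S, ?_, Matrix.of fun i k => (b k : EuclideanSpace ℝ (Fin m)) i, ?_, ?_⟩
  · exact (finrank_range_le_card (R := ℝ) g).trans_eq (Fintype.card_fin r)
  · ext k l
    have h := orthonormal_iff_ite.mp b.orthonormal k l
    rw [Submodule.coe_inner, PiLp.inner_apply] at h
    rw [mul_apply, one_apply, ← h]
    exact Finset.sum_congr rfl fun i _ => mul_comm _ _
  · ext i a
    have h := b.sum_repr' ⟨g a, Submodule.subset_span ⟨a, rfl⟩⟩
    have h' := congrArg (fun v : S => (v : EuclideanSpace ℝ (Fin m)) i) h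
    simp only [Submodule.coe_inner, PiLp.inner_apply, Submodule.coe_sum, Submodule.coe_smul,
      WithLp.ofLp_sum, WithLp.ofLp_smul, Finset.sum_apply, Pi.smul_apply] at h'
    rw [Matrix.mul_assoc]
    refine Eq.trans ?_ h'
    rw [mul_apply]
    refine Finset.sum_congr rfl fun k _ => ?_
    rw [mul_apply, smul_eq_mul, mul_comm]
    exact congrArg (· * _) (Finset.sum_congr rfl fun i _ => mul_comm _ _)

/-- A weighted sum of an antitone nonnegative sequence, with weights in `[0, 1]` of total mass at
most `r`, is at most the sum of the first `r` terms. -/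
lemma sum_mul_le_sum_castLE {m r : ℕ} (hr : r ≤ m) (g w : Fin m → ℝ) (hg : Antitone g)
    (hg0 : ∀ i, 0 ≤ g i) (hw0 : ∀ i, 0 ≤ w i) (hw1 : ∀ i, w i ≤ 1) (hw : ∑ i, w i ≤ r) :
    ∑ i, g i * w i ≤ ∑ j : Fin r, g (Fin.castLE hr j) := by
  obtain ⟨t, ht0, hlo, hhi⟩ : ∃ t : ℝ, (r = 0 ∨ 0 ≤ t) ∧ (∀ i : Fin m, (i : ℕ) < r → t ≤ g i) ∧
      (∀ i : Fin m, r ≤ (i : ℕ) → g i * w i ≤ t * w i) := by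
    rcases Nat.eq_zero_or_pos r with rfl | hpos
    · refine ⟨0, Or.inl rfl, fun i hi => absurd hi (by omega), fun i _ => ?_⟩
      have : w i ≤ 0 := (Finset.single_le_sum (fun j _ => hw0 j) (Finset.mem_univ i)).trans
        (by simpa using hw)
      rw [le_antisymm this (hw0 i)]
      simp
    · refine ⟨g ⟨r - 1, by omega⟩, Or.inr (hg0 _), fun i hi => hg ?_, fun i hi =>
        mul_le_mul_of_nonneg_right (hg ?_) (hw0 i)⟩
      · rw [Fin.le_def]; simp only; omega
      · rw [Fin.le_def]; simp only; omega
  have hsum : ∑ j : Fin r, (g (Fin.castLE hr j) - t) =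
      ∑ i : Fin m, if (i : ℕ) < r then g i - t else 0 := by
    obtain ⟨s, rfl⟩ := Nat.exists_eq_add_of_le hr
    rw [Fin.sum_univ_add]
    simp
    rfl
  have hle : ∑ i, g i * w i ≤ ∑ i : Fin m, ((if (i : ℕ) < r then g i - t else 0) + t * w i) := by
    refine Finset.sum_le_sum fun i _ => ?_
    split_ifs with hi
    · nlinarith [mul_nonneg (sub_nonneg.mpr (hlo i hi)) (sub_nonneg.mpr (hw1 i))]
    · simpa using hhi i (not_lt.mp hi)
  rw [Finset.sum_add_distrib, ← hsum, Finset.sum_sub_distrib, ← Finset.mul_sum] at hle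
  simp only [Finset.sum_const, Finset.card_univ, Fintype.card_fin, nsmul_eq_mul] at hle
  rcases ht0 with rfl | ht0
  · have hz : ∑ i, w i = 0 := le_antisymm (by simpa using hw) (Finset.sum_nonneg fun i _ => hw0 i)
    simpa [hz] using hle
  · nlinarith [mul_le_mul_of_nonneg_left hw ht0]

lemma sum_ite_val_eq_le {m n : ℕ} (f : Fin m → ℝ) (hf : ∀ i, 0 ≤ f i) :
    ∑ i : Fin m, ∑ j : Fin n, (if (i : ℕ) = (j : ℕ) then f i else 0) ≤ ∑ i, f i := by
  refine Finset.sum_le_sum fun i _ => ?_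
  by_cases hi : (i : ℕ) < n
  · rw [Finset.sum_eq_single ⟨i, hi⟩]
    · simp
    · intro j _ hj
      rw [if_neg fun h => hj (Fin.ext h.symm)]
    · simp
  · rw [Finset.sum_eq_zero fun j _ => if_neg (by omega)]
    exact hf i

lemma trace_transpose_mul_eq_sum {m n : Type*} [Fintype m] [Fintype n] (A B : Matrix m n ℝ) :
    (Aᵀ * B).trace = ∑ i, ∑ j, A i j * B i j := by
  rw [Finset.sum_comm]
  simp [trace, mul_apply]

/-- A rectangular diagonal matrix with entries in `[0, √(γ₁ γ₂)]` pairs with `G Hᵀ` to at most the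
ridge penalty of `(G, H)`. -/
lemma trace_diag_mul_le_ridge {m n r : ℕ} (N : Matrix (Fin m) (Fin n) ℝ) (γ₁ γ₂ : ℝ)
    (h1 : 0 < γ₁) (h2 : 0 < γ₂) (hoff : ∀ (i : Fin m) (j : Fin n), (i : ℕ) ≠ (j : ℕ) → N i j = 0)
    (h0 : ∀ i j, 0 ≤ N i j) (hN : ∀ i j, N i j ≤ Real.sqrt (γ₁ * γ₂))
    (G : Matrix (Fin m) (Fin r) ℝ) (H : Matrix (Fin n) (Fin r) ℝ) :
    (Nᵀ * (G * Hᵀ)).trace ≤ γ₁ / 2 * frobNorm G ^ 2 + γ₂ / 2 * frobNorm H ^ 2 := by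
  have hf {p : ℕ} (A : Matrix (Fin p) (Fin r) ℝ) (i : Fin p) : 0 ≤ ∑ a, A i a ^ 2 :=
    Finset.sum_nonneg fun a _ => sq_nonneg _
  have hG := sum_ite_val_eq_le (n := n) (fun i => ∑ a, G i a ^ 2) (hf G)
  have hH := sum_ite_val_eq_le (n := m) (fun i => ∑ a, H i a ^ 2) (hf H)
  rw [Finset.sum_comm] at hH
  rw [trace_transpose_mul_eq_sum, frobNorm, frobNorm, Real.sq_sqrt (by positivity),
    Real.sq_sqrt (by positivity)]
  refine le_trans ?_ (add_le_add (mul_le_mul_of_nonneg_left hG (half_pos h1).le)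
    (mul_le_mul_of_nonneg_left hH (half_pos h2).le))
  simp only [Finset.mul_sum, ← Finset.sum_add_distrib]
  refine Finset.sum_le_sum fun i _ => Finset.sum_le_sum fun j _ => ?_
  by_cases hij : (i : ℕ) = (j : ℕ)
  · simp only [hij, if_true, mul_apply, transpose_apply, Finset.mul_sum, ← Finset.sum_add_distrib]
    refine Finset.sum_le_sum fun a _ => ?_
    have hle : N i j * (G i a * H j a) ≤ Real.sqrt (γ₁ * γ₂) * |G i a * H j a| :=
      (mul_le_mul_of_nonneg_left (le_abs_self _) (h0 i j)).trans
        (mul_le_mul_of_nonneg_right (hN i j) (abs_nonneg _))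
    rw [abs_mul, Real.sqrt_mul h1.le] at hle
    have hsq := sq_nonneg (Real.sqrt γ₁ * |G i a| - Real.sqrt γ₂ * |H j a|)
    rw [sub_sq, mul_pow, mul_pow, Real.sq_sqrt h1.le, Real.sq_sqrt h2.le, sq_abs, sq_abs] at hsq
    linarith
  · simp [hij, Ne.symm hij, hoff i j hij]

/-- A rectangular diagonal matrix with decreasing nonnegative diagonal pairs with a matrix `G Hᵀ` of
rank at most `r` as bounded by its `r` leading entries. -/
lemma trace_diag_mul_le_of_rank_le {m n r : ℕ} (hr : r ≤ min m n) (μ : ℕ → ℝ)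
    (hmono : ∀ k l : ℕ, k ≤ l → l < min m n → μ l ≤ μ k) (hpos : ∀ k, k < min m n → 0 ≤ μ k)
    (M : Matrix (Fin m) (Fin n) ℝ)
    (hM : ∀ i j, M i j = if (i : ℕ) = (j : ℕ) then μ (i : ℕ) else 0)
    (G : Matrix (Fin m) (Fin r) ℝ) (H : Matrix (Fin n) (Fin r) ℝ) :
    (Mᵀ * (G * Hᵀ)).trace ≤ 1 / 2 * frobNorm (G * Hᵀ) ^ 2 + 1 / 2 * ∑ j : Fin r, μ j ^ 2 := by
  obtain ⟨k, hk, E, hE, hEG⟩ := exists_orthonormal_columns G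
  have hcross : ((E * (Eᵀ * M))ᵀ * (G * Hᵀ)).trace = (Mᵀ * (G * Hᵀ)).trace := by
    conv_rhs => rw [← hEG]
    simp only [transpose_mul, transpose_transpose, Matrix.mul_assoc]
  have hexp := sq_frobNorm_sub (E * (Eᵀ * M)) (G * Hᵀ)
  rw [hcross, sq_frobNorm_mul_of_transpose_mul_self hE] at hexp
  have hnn := sq_nonneg (frobNorm (E * (Eᵀ * M) - G * Hᵀ))
  let Q := E * Eᵀ
  have hQQ : Q * Q = Q := by
    simp only [Q]
    rw [Matrix.mul_assoc, ← Matrix.mul_assoc Eᵀ, hE, Matrix.one_mul]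
  have hQs (i j) : Q i j = Q j i := by simp [Q, mul_apply, mul_comm]
  have hQd (i) : Q i i = ∑ j, Q i j ^ 2 := by
    conv_lhs => rw [← hQQ, mul_apply]
    exact Finset.sum_congr rfl fun j _ => by rw [hQs j i, sq]
  have hQ0 (i) : 0 ≤ Q i i := by rw [hQd]; positivity
  have hQ1 (i) : Q i i ≤ 1 := by
    have : Q i i ^ 2 ≤ Q i i := by
      conv_rhs => rw [hQd]
      exact Finset.single_le_sum (f := fun j => Q i j ^ 2) (fun j _ => sq_nonneg _)
        (Finset.mem_univ i)
    nlinarith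
  have hQt : ∑ i, Q i i ≤ r := by
    have : Q.trace = k := by rw [trace_mul_comm, hE]; simp
    rw [trace] at this
    simp only [diag_apply] at this
    rw [this]
    exact_mod_cast hk
  let g : Fin m → ℝ := fun i => if (i : ℕ) < n then μ i ^ 2 else 0
  have hg : Antitone g := by
    intro i j hij
    have hij' : (i : ℕ) ≤ j := hij
    simp only [g]
    split_ifs with hj hi hi
    · exact pow_le_pow_left₀ (hpos _ (by omega)) (hmono _ _ hij' (by omega)) 2
    · omega
    · positivity
    · exact le_rfl
  have hsum := sum_mul_le_sum_castLE (hr.trans (min_le_left m n)) g (fun i => Q i i) hg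
    (fun i => by simp only [g]; split_ifs <;> positivity) hQ0 hQ1 hQt
  have hleft : frobNorm (Eᵀ * M) ^ 2 = ∑ i, g i * Q i i := by
    have : frobNorm (Eᵀ * M) ^ 2 = (Mᵀ * (Q * M)).trace := by
      rw [sq_frobNorm]
      simp only [Q, transpose_mul, transpose_transpose, Matrix.mul_assoc]
    rw [this, trace_transpose_mul_eq_sum]
    refine Finset.sum_congr rfl fun i _ => ?_
    simp only [g]
    split_ifs with hi
    · rw [Finset.sum_eq_single ⟨i, hi⟩]
      · rw [mul_apply, Finset.sum_eq_single i]
        · simp only [hM, if_true]; ring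
        · intro l _ hl
          rw [hM, if_neg fun h => hl (Fin.ext h), mul_zero]
        · simp
      · intro j _ hj
        rw [hM, if_neg fun h => hj (Fin.ext h.symm), zero_mul]
      · simp
    · rw [zero_mul]
      exact Finset.sum_eq_zero fun j _ => by rw [hM, if_neg (by omega), zero_mul]
  have hright : ∑ j : Fin r, g (Fin.castLE (hr.trans (min_le_left m n)) j) =
      ∑ j : Fin r, μ j ^ 2 := by
    refine Finset.sum_congr rfl fun j _ => ?_
    have hj : (j : ℕ) < n := by omega
    simp [g, hj]
  linarith

lemma trace_svd_mul_le {m n r : ℕ} (hr : r ≤ min m n) (d : ℕ → ℝ)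
    (hmono : ∀ k l : ℕ, k ≤ l → l < min m n → d l ≤ d k)
    (hpos : ∀ k : ℕ, k < min m n → 0 ≤ d k)
    (D : Matrix (Fin m) (Fin n) ℝ)
    (hD : ∀ i j, D i j = if (i : ℕ) = (j : ℕ) then d (i : ℕ) else 0)
    (γ₁ γ₂ : ℝ) (h1 : 0 < γ₁) (h2 : 0 < γ₂)
    (G : Matrix (Fin m) (Fin r) ℝ) (H : Matrix (Fin n) (Fin r) ℝ) :
    (Dᵀ * (G * Hᵀ)).trace ≤ 1 / 2 * frobNorm (G * Hᵀ) ^ 2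
      + (γ₁ / 2 * frobNorm G ^ 2 + γ₂ / 2 * frobNorm H ^ 2)
      + 1 / 2 * ∑ j : Fin r, (max (d j - Real.sqrt (γ₁ * γ₂)) 0) ^ 2 := by
  set c := Real.sqrt (γ₁ * γ₂) with hc
  have hc0 : 0 ≤ c := Real.sqrt_nonneg _
  let M : Matrix (Fin m) (Fin n) ℝ :=
    Matrix.of fun i j => if (i : ℕ) = (j : ℕ) then max (d i - c) 0 else 0
  have hlead := trace_diag_mul_le_of_rank_le hr (fun k => max (d k - c) 0)
    (fun k l hkl hl => max_le_max_right 0 (sub_le_sub_right (hmono k l hkl hl) c))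
    (fun k _ => le_max_right _ _) M (fun i j => rfl) G H
  have hrest := trace_diag_mul_le_ridge (D - M) γ₁ γ₂ h1 h2
    (fun i j hij => by simp [M, hD, hij])
    (fun i j => by
      simp only [Matrix.sub_apply, M, hD, of_apply]
      split_ifs with hij
      · have := hpos i (by omega)
        exact sub_nonneg.mpr (max_le (by linarith) this)
      · simp)
    (fun i j => by
      simp only [Matrix.sub_apply, M, hD, of_apply, ← hc]
      split_ifs with hij
      · linarith [le_max_left (d i - c) 0]
      · simpa using hc0) G H
  rw [transpose_sub, Matrix.sub_mul, trace_sub] at hrest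
  linarith

/-- Given a full SVD `Z = U D Vᵀ`, `r ≤ min(m,n)` and `γ₁, γ₂ > 0`, the matrices
`F̄ = (γ₂/γ₁)^{1/4} U_r (D̄_r^γ)^{1/2}` and `Λ̄ = (γ₁/γ₂)^{1/4} V_r (D̄_r^γ)^{1/2}`, where
`D̄_r^γ` has entries `max(dᵢ − √(γ₁γ₂), 0)`, globally minimize the unequally weighted
regularized objective, and the common component is `F̄ Λ̄ᵀ = U_r D̄_r^γ V_rᵀ`. -/
theorem generalized_rpca_solution {m n r : ℕ} (hr : r ≤ min m n)
    (Z : Matrix (Fin m) (Fin n) ℝ)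
    (U : Matrix (Fin m) (Fin m) ℝ) (V : Matrix (Fin n) (Fin n) ℝ)
    (hU : Uᵀ * U = 1) (hV : Vᵀ * V = 1)
    (d : ℕ → ℝ)
    (hmono : ∀ k l : ℕ, k ≤ l → l < min m n → d l ≤ d k)
    (hpos : ∀ k : ℕ, k < min m n → 0 ≤ d k)
    (D : Matrix (Fin m) (Fin n) ℝ)
    (hD : ∀ i j, D i j = if (i : ℕ) = (j : ℕ) then d (i : ℕ) else 0)
    (hZ : Z = U * D * Vᵀ)
    (γ₁ γ₂ : ℝ) (h1 : 0 < γ₁) (h2 : 0 < γ₂) :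
    let Ur : Matrix (Fin m) (Fin r) ℝ :=
      Matrix.of fun i j => U i (Fin.castLE (hr.trans (min_le_left m n)) j)
    let Vr : Matrix (Fin n) (Fin r) ℝ :=
      Matrix.of fun i j => V i (Fin.castLE (hr.trans (min_le_right m n)) j)
    let Dbar : Matrix (Fin r) (Fin r) ℝ :=
      Matrix.diagonal fun j : Fin r => max (d (j : ℕ) - Real.sqrt (γ₁ * γ₂)) 0
    let Fbar := ((γ₂ / γ₁) ^ ((1 : ℝ) / 4)) •
      (Ur * Matrix.diagonal fun j : Fin r => Real.sqrt (max (d (j : ℕ) - Real.sqrt (γ₁ * γ₂)) 0))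
    let Λbar := ((γ₁ / γ₂) ^ ((1 : ℝ) / 4)) •
      (Vr * Matrix.diagonal fun j : Fin r => Real.sqrt (max (d (j : ℕ) - Real.sqrt (γ₁ * γ₂)) 0))
    (∀ (F : Matrix (Fin m) (Fin r) ℝ) (Λ : Matrix (Fin n) (Fin r) ℝ),
      (1 / 2) * frobNorm (Z - Fbar * Λbarᵀ) ^ 2 + (γ₁ / 2) * frobNorm Fbar ^ 2
          + (γ₂ / 2) * frobNorm Λbar ^ 2 ≤
        (1 / 2) * frobNorm (Z - F * Λᵀ) ^ 2 + (γ₁ / 2) * frobNorm F ^ 2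
          + (γ₂ / 2) * frobNorm Λ ^ 2) ∧
    Fbar * Λbarᵀ = Ur * Dbar * Vrᵀ := by
  set c := Real.sqrt (γ₁ * γ₂)
  intro Ur Vr Dbar Fbar Λbar
  have hUU : U * Uᵀ = 1 := mul_eq_one_comm.mp hU
  have hVV : V * Vᵀ = 1 := mul_eq_one_comm.mp hV
  have hUr : Urᵀ * Ur = 1 := by
    ext a b
    have h := congrFun (congrFun hU (Fin.castLE (hr.trans (min_le_left m n)) a))
      (Fin.castLE (hr.trans (min_le_left m n)) b)
    simpa [mul_apply, one_apply, Ur] using h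
  have hVr : Vrᵀ * Vr = 1 := by
    ext a b
    have h := congrFun (congrFun hV (Fin.castLE (hr.trans (min_le_right m n)) a))
      (Fin.castLE (hr.trans (min_le_right m n)) b)
    simpa [mul_apply, one_apply, Vr] using h
  have hZr : Vrᵀ * Zᵀ * Ur = diagonal fun j : Fin r => d j := by
    have hrot : Vᵀ * Zᵀ * U = Dᵀ := by
      rw [hZ]
      simp only [transpose_mul, transpose_transpose, Matrix.mul_assoc, hU, Matrix.mul_one]
      rw [← Matrix.mul_assoc, hV, Matrix.one_mul]
    ext a b
    have h := congrFun (congrFun hrot (Fin.castLE (hr.trans (min_le_right m n)) a))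
      (Fin.castLE (hr.trans (min_le_left m n)) b)
    rw [transpose_apply, hD] at h
    refine Eq.trans ?_ (h.trans ?_)
    · simp [mul_apply, Ur, Vr]
    · by_cases hab : a = b
      · simp [hab]
      · have : (b : ℕ) ≠ a := fun h => hab (Fin.ext h.symm)
        simp [hab, this]
  have hmax0 (j : Fin r) : 0 ≤ max (d j - c) 0 := le_max_right _ _
  have hcomp : Fbar * Λbarᵀ = Ur * Dbar * Vrᵀ := by
    have hs : (γ₁ / γ₂) ^ ((1 : ℝ) / 4) * (γ₂ / γ₁) ^ ((1 : ℝ) / 4) = 1 := by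
      rw [← Real.mul_rpow (by positivity) (by positivity), div_mul_div_cancel₀ h2.ne',
        div_self h1.ne', Real.one_rpow]
    simp only [Fbar, Λbar, Dbar, transpose_smul, Matrix.smul_mul, Matrix.mul_smul, smul_smul, hs,
      one_smul, transpose_mul, diagonal_transpose]
    rw [Matrix.mul_assoc, ← Matrix.mul_assoc (diagonal _), diagonal_mul_diagonal,
      ← Matrix.mul_assoc]
    simp only [Real.mul_self_sqrt (hmax0 _)]
  refine ⟨fun F Λ => ?_, hcomp⟩
  have hweight (a b : ℝ) (ha : 0 < a) (hb : 0 < b) :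
      a * ((b / a) ^ ((1 : ℝ) / 4)) ^ 2 = Real.sqrt (a * b) := by
    rw [← Real.rpow_natCast, ← Real.rpow_mul (by positivity)]
    norm_num
    rw [← Real.sqrt_eq_rpow, Real.sqrt_div hb.le, Real.sqrt_mul ha.le]
    have := Real.sqrt_pos.mpr ha
    field_simp
    rw [Real.sq_sqrt ha.le]
  have hdiag : frobNorm (diagonal fun j : Fin r => Real.sqrt (max (d j - c) 0)) ^ 2 =
      ∑ j : Fin r, max (d j - c) 0 := by
    rw [sq_frobNorm, diagonal_transpose, diagonal_mul_diagonal, trace_diagonal]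
    simp only [Real.mul_self_sqrt (hmax0 _)]
  have hF : γ₁ * frobNorm Fbar ^ 2 = c * ∑ j : Fin r, max (d j - c) 0 := by
    rw [sq_frobNorm_smul, sq_frobNorm_mul_of_transpose_mul_self hUr, hdiag, ← mul_assoc,
      hweight γ₁ γ₂ h1 h2]
  have hΛ : γ₂ * frobNorm Λbar ^ 2 = c * ∑ j : Fin r, max (d j - c) 0 := by
    rw [sq_frobNorm_smul, sq_frobNorm_mul_of_transpose_mul_self hVr, hdiag, ← mul_assoc,
      hweight γ₂ γ₁ h2 h1, mul_comm γ₂]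
  have hfit : frobNorm (Ur * Dbar * Vrᵀ) ^ 2 = ∑ j : Fin r, max (d j - c) 0 ^ 2 := by
    rw [Matrix.mul_assoc, sq_frobNorm_mul_of_transpose_mul_self hUr, ← frobNorm_transpose,
      transpose_mul, transpose_transpose, sq_frobNorm_mul_of_transpose_mul_self hVr, sq_frobNorm]
    simp [Dbar, sq]
  have hcross : (Zᵀ * (Ur * Dbar * Vrᵀ)).trace = ∑ j : Fin r, d j * max (d j - c) 0 := by
    rw [← Matrix.mul_assoc, trace_mul_comm, ← Matrix.mul_assoc, ← Matrix.mul_assoc, hZr,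
      diagonal_mul_diagonal, trace_diagonal]
  have hshrink : ∑ j : Fin r, d j * max (d j - c) 0 =
      ∑ j : Fin r, max (d j - c) 0 ^ 2 + c * ∑ j : Fin r, max (d j - c) 0 := by
    rw [Finset.mul_sum, ← Finset.sum_add_distrib]
    refine Finset.sum_congr rfl fun j _ => ?_
    rcases max_cases (d j - c) 0 with ⟨h, _⟩ | ⟨h, _⟩ <;> rw [h] <;> ring
  have hbound := trace_svd_mul_le hr d hmono hpos D hD γ₁ γ₂ h1 h2 (Uᵀ * F) (Vᵀ * Λ)
  have hUU' : Uᵀᵀ * Uᵀ = 1 := by rwa [transpose_transpose]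
  have hVV' : Vᵀᵀ * Vᵀ = 1 := by rwa [transpose_transpose]
  have hX : Uᵀ * F * (Vᵀ * Λ)ᵀ = Uᵀ * (F * Λᵀ * V) := by
    simp only [transpose_mul, transpose_transpose, Matrix.mul_assoc]
  have hXnorm : frobNorm (Uᵀ * (F * Λᵀ * V)) ^ 2 = frobNorm (F * Λᵀ) ^ 2 := by
    rw [sq_frobNorm_mul_of_transpose_mul_self hUU', ← frobNorm_transpose, transpose_mul,
      sq_frobNorm_mul_of_transpose_mul_self hVV', frobNorm_transpose]
  have hXtrace : (Dᵀ * (Uᵀ * (F * Λᵀ * V))).trace = (Zᵀ * (F * Λᵀ)).trace := by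
    rw [hZ, ← Matrix.mul_assoc, ← Matrix.mul_assoc, trace_mul_comm]
    simp only [transpose_mul, transpose_transpose, Matrix.mul_assoc]
  rw [hX, hXnorm, hXtrace, sq_frobNorm_mul_of_transpose_mul_self hUU',
    sq_frobNorm_mul_of_transpose_mul_self hVV'] at hbound
  rw [hcomp, sq_frobNorm_sub, sq_frobNorm_sub, hfit, hcross, hshrink]
  linarith
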